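/- arXiv:1704.07716 — 8 statements merged into one kernel-verified Lean document; each statement's English description precedes it below -/
import Mathlib

section
/- Let n ≥ 2 be an integer and let k be an integer with 1 ≤ k ≤ ⌈n/2⌉. Then γ(n,[1,n−k],[2,n]) = n−1. In particular, the minimum cardinality of a system of unbiased representatives for the family of all non-trivial bicolorings B of [n] with 1 ≤ |B(+1)| ≤ n−k, using sets of any size between 2 and n, equals n−1. -/
/-- `gammaGen n k1 k2 r1 r2` is the minimum cardinality of a family `A` of subsets of `[n]`,
each of size between `r1` and `r2`, such that every non-trivial bicoloring `B` of `[n]`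
(identified with its `+1`-class `P`) with `k1 <= |B(+1)| <= k2` has an unbiased representative
in the family, i.e. some member `A` with `|A ∩ B(+1)| = |A ∩ B(-1)|`. -/
noncomputable def gammaGen (n k₁ k₂ r₁ r₂ : ℕ) : ℕ :=
  sInf {m | ∃ 𝒜 : Finset (Finset (Fin n)),
    𝒜.card = m ∧
    (∀ A ∈ 𝒜, r₁ ≤ A.card ∧ A.card ≤ r₂) ∧
    (∀ P : Finset (Fin n), k₁ ≤ P.card → P.card ≤ k₂ →
      ∃ A ∈ 𝒜, (A ∩ P).card = (A ∩ Pᶜ).card)}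

open Finset

/-- A product of fewer than `#S` linear forms is orthogonal to the character of `S` on the
sign cube. -/
lemma sum_signs_prod_mul_prod_sum_eq_zero {ι : Type*} [Fintype ι] [DecidableEq ι]
    (𝒜 : Finset (Finset ι)) (S : Finset ι) (h : 𝒜.card < S.card) :
    ∑ y : ι → ℤˣ, (∏ i ∈ S, (y i : ℤ)) * ∏ A ∈ 𝒜, ∑ i ∈ A, (y i : ℤ) = 0 := by
  induction 𝒜 using Finset.induction_on generalizing S with
  | empty =>
    obtain ⟨i, hi⟩ := card_pos.mp (by simpa using h)
    have key := Fintype.prod_sum fun (j : ι) (u : ℤˣ) ↦ if j ∈ S then (u : ℤ) else 1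
    have hzero : ∏ j : ι, ∑ u : ℤˣ, (if j ∈ S then (u : ℤ) else 1) = 0 :=
      prod_eq_zero (mem_univ i) (by simp only [hi, if_true]; decide)
    rw [hzero] at key
    simpa using key.symm
  | insert A 𝒜 hA ih =>
    rw [card_insert_of_notMem hA] at h
    simp only [prod_insert hA, sum_mul, mul_sum]
    rw [sum_comm]
    refine sum_eq_zero fun i _ ↦ ?_
    by_cases hi : i ∈ S
    · rw [← ih (S.erase i) (by rw [card_erase_of_mem hi]; omega)]
      refine sum_congr rfl fun y _ ↦ ?_
      rw [← mul_prod_erase S _ hi]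
      have hsq : (y i : ℤ) * y i = 1 := Int.units_coe_mul_self _
      linear_combination (∏ j ∈ S.erase i, (y j : ℤ)) * (∏ A ∈ 𝒜, ∑ j ∈ A, (y j : ℤ)) * hsq
    · rw [← ih (insert i S) (by rw [card_insert_of_notMem hi]; omega)]
      refine sum_congr rfl fun y _ ↦ ?_
      rw [prod_insert hi]
      ring

/-- The sum of the signs over `A` vanishes when `A` is balanced for the positive class. -/
lemma sum_signs_eq_zero_of_card_inter_eq {ι : Type*} [Fintype ι] [DecidableEq ι]
    (y : ι → ℤˣ) (A : Finset ι)
    (h : (A ∩ univ.filter fun i ↦ y i = 1).card = (A ∩ (univ.filter fun i ↦ y i = 1)ᶜ).card) :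
    ∑ i ∈ A, (y i : ℤ) = 0 := by
  have hy : ∀ i ∈ A, (y i : ℤ) = if y i = 1 then 1 else -1 := fun i _ ↦ by
    rcases Int.units_eq_one_or (y i) with h | h <;> rw [h] <;> decide
  have h1 : A ∩ univ.filter (fun i ↦ y i = 1) = A.filter fun i ↦ y i = 1 := by ext; simp
  have h2 : A ∩ (univ.filter fun i ↦ y i = 1)ᶜ = A.filter fun i ↦ ¬ y i = 1 := by ext; simp
  rw [h1, h2] at h
  rw [sum_congr rfl hy, sum_ite]
  simp [h]

/-- Non-empty sets balancing every non-constant sign vector number at least `#ι - 1`. -/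
lemma card_le_card_add_one_of_balancing {ι : Type*} [Fintype ι] [DecidableEq ι] [Nonempty ι]
    (𝒜 : Finset (Finset ι)) (hne : ∀ A ∈ 𝒜, A.Nonempty)
    (h : ∀ y : ι → ℤˣ, y ≠ 1 → y ≠ -1 → ∃ A ∈ 𝒜, ∑ i ∈ A, (y i : ℤ) = 0) :
    Fintype.card ι ≤ 𝒜.card + 1 := by
  by_contra! hlt
  obtain ⟨S, -, hS⟩ := exists_subset_card_eq (s := (univ : Finset ι)) (n := 𝒜.card + 2)
    (by rw [card_univ]; omega)
  have key := sum_signs_prod_mul_prod_sum_eq_zero 𝒜 S (by omega)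
  have hpm : (1 : ι → ℤˣ) ≠ -1 := fun e ↦ by
    have := congrFun e (Classical.arbitrary ι)
    revert this
    simp
  have hsub : ∑ y ∈ ({1, -1} : Finset (ι → ℤˣ)),
      (∏ i ∈ S, (y i : ℤ)) * ∏ A ∈ 𝒜, ∑ i ∈ A, (y i : ℤ) = 0 := by
    rw [← key]
    refine sum_subset (subset_univ _) fun y _ hy ↦ ?_
    simp only [mem_insert, mem_singleton, not_or] at hy
    obtain ⟨A, hA, hA0⟩ := h y hy.1 hy.2
    rw [prod_eq_zero hA hA0, mul_zero]
  have hpos : (0 : ℤ) < ∏ A ∈ 𝒜, (A.card : ℤ) :=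
    prod_pos fun A hA ↦ by exact_mod_cast (hne A hA).card_pos
  have hsign : ((-1 : ℤ) ^ 𝒜.card) * (-1) ^ 𝒜.card = 1 := by
    rw [← mul_pow]; simp
  rw [sum_pair hpm] at hsub
  simp only [Pi.one_apply, Pi.neg_apply, Units.val_one, Units.val_neg, prod_const, sum_const,
    hS, one_pow, one_mul, nsmul_eq_mul, mul_one, mul_neg, prod_neg, pow_add] at hsub
  have : ((-1 : ℤ) ^ 𝒜.card) * (-1) ^ 2 * ((-1) ^ 𝒜.card * ∏ A ∈ 𝒜, (A.card : ℤ)) =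
      ∏ A ∈ 𝒜, (A.card : ℤ) := by
    linear_combination (∏ A ∈ 𝒜, (A.card : ℤ)) * hsign
  linarith

/-- A non-trivial subset of `Fin (m + 1)` separates two consecutive points. -/
lemma exists_castSucc_mem_xor_succ_mem {m : ℕ} (P : Finset (Fin (m + 1)))
    (hP : P.Nonempty) (hP' : P ≠ univ) :
    ∃ i : Fin m, ¬ (i.castSucc ∈ P ↔ i.succ ∈ P) := by
  by_contra! h
  have h0 : ∀ j : Fin (m + 1), j ∈ P ↔ 0 ∈ P := fun j ↦ by
    induction j using Fin.induction with
    | zero => rfl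
    | succ i ih => rw [← h i, ih]
  obtain ⟨j, hj⟩ := hP
  exact hP' (eq_univ_of_forall fun l ↦ (h0 l).2 ((h0 j).1 hj))

/-- A pair separated by `P` is balanced for `P`. -/
lemma card_pair_inter_eq {ι : Type*} [Fintype ι] [DecidableEq ι] (P : Finset ι) {a b : ι}
    (h : ¬ (a ∈ P ↔ b ∈ P)) :
    (({a, b} : Finset ι) ∩ P).card = (({a, b} : Finset ι) ∩ Pᶜ).card := by
  by_cases ha : a ∈ P <;> by_cases hb : b ∈ P <;>
    simp_all [insert_inter_of_mem, insert_inter_of_notMem]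

/-- Theorem 1: for `n ≥ 2` and `1 ≤ k ≤ ⌈n/2⌉`, the minimum cardinality of a system of
unbiased representatives (with sets of size between 2 and n) for all non-trivial bicolorings
B of [n] with `1 ≤ |B(+1)| ≤ n - k` equals `n - 1`. -/
theorem stmt_0 (n k : ℕ) (hn : 2 ≤ n) (hk1 : 1 ≤ k) (hk2 : k ≤ (n + 1) / 2) :
    gammaGen n 1 (n - k) 2 n = n - 1 := by
  obtain ⟨m, rfl⟩ : ∃ m, n = m + 1 := ⟨n - 1, by omega⟩
  have hpairs : (univ.image fun i : Fin m ↦ ({i.castSucc, i.succ} : Finset (Fin (m + 1)))).card ∈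
      {c | ∃ 𝒜 : Finset (Finset (Fin (m + 1))),
        𝒜.card = c ∧
        (∀ A ∈ 𝒜, 2 ≤ A.card ∧ A.card ≤ m + 1) ∧
        (∀ P : Finset (Fin (m + 1)), 1 ≤ P.card → P.card ≤ m + 1 - k →
          ∃ A ∈ 𝒜, (A ∩ P).card = (A ∩ Pᶜ).card)} := by
    refine ⟨_, rfl, fun A hA ↦ ?_, fun P hP1 hP2 ↦ ?_⟩
    · obtain ⟨i, -, rfl⟩ := mem_image.mp hA
      rw [card_pair i.castSucc_lt_succ.ne]
      omega
    · obtain ⟨i, hi⟩ := exists_castSucc_mem_xor_succ_mem P (card_pos.mp hP1) (by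
        rintro rfl
        rw [card_univ, Fintype.card_fin] at hP2
        omega)
      exact ⟨_, mem_image_of_mem _ (mem_univ i), card_pair_inter_eq P hi⟩
  refine le_antisymm ((Nat.sInf_le hpairs).trans (card_image_le.trans (by simp))) ?_
  refine le_csInf ⟨_, hpairs⟩ ?_
  rintro _ ⟨𝒜, rfl, hsize, hcover⟩
  have hbound := card_le_card_add_one_of_balancing 𝒜
    (fun A hA ↦ card_pos.mp (by have := (hsize A hA).1; omega)) fun y hy1 hy2 ↦ by
      set P := univ.filter fun i ↦ y i = 1 with hPdef
      have hne : P.Nonempty := by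
        by_contra hempty
        refine hy2 (funext fun i ↦ (Int.units_eq_one_or (y i)).resolve_left fun hi ↦ ?_)
        exact hempty ⟨i, by simp [hPdef, hi]⟩
      have hne' : Pᶜ.Nonempty := by
        by_contra hempty
        refine hy1 (funext fun i ↦ ?_)
        by_contra hi
        exact hempty ⟨i, by simpa [hPdef] using hi⟩
      have hcard : P.card + Pᶜ.card = m + 1 := by simp [card_add_card_compl]
      have h1 := hne.card_pos
      have h2 := hne'.card_pos
      by_cases hle : P.card ≤ m + 1 - k
      · obtain ⟨A, hA, hAP⟩ := hcover P h1 hle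
        exact ⟨A, hA, sum_signs_eq_zero_of_card_inter_eq y A hAP⟩
      · obtain ⟨A, hA, hAP⟩ := hcover Pᶜ h2 (by omega)
        rw [compl_compl] at hAP
        exact ⟨A, hA, sum_signs_eq_zero_of_card_inter_eq y A hAP.symm⟩
  rw [Fintype.card_fin] at hbound
  omega
end

section
/- Let n ≥ 2 be an integer and let k be an integer with 1 ≤ k ≤ n−1. Then n/2 ≤ γ(n,1,[2,n]) ≤ γ(n,[1,n−k],[2,n]). In particular, any system of unbiased representatives for the family of the n bicolorings B of [n] with |B(+1)| = 1 has cardinality at least n/2. -/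
open Finset in
/-- A non-empty set balanced by a singleton `{x}` is a pair containing `x`. -/
theorem mem_and_card_eq_two_of_balanced_singleton {α : Type*} [Fintype α] [DecidableEq α]
    {A : Finset α} {x : α} (hA : A.Nonempty)
    (h : (A ∩ {x}).card = (A ∩ {x}ᶜ).card) : x ∈ A ∧ A.card = 2 := by
  have hsum : (A ∩ {x}).card + (A ∩ {x}ᶜ).card = A.card := by
    rw [← sdiff_eq_inter_compl]
    exact card_inter_add_card_sdiff A {x}
  have hpos := hA.card_pos
  by_cases hx : x ∈ A
  · rw [inter_singleton_of_mem hx, card_singleton] at h hsum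
    exact ⟨hx, by omega⟩
  · rw [inter_singleton_of_notMem hx, card_empty] at h hsum
    omega

/-- A system of unbiased representatives for all bicolorings with one `+1`-point has at least
half as many members as there are points. -/
theorem card_le_two_mul_card_of_balances_singletons {α : Type*} [Fintype α] [DecidableEq α]
    (𝒜 : Finset (Finset α))
    (h : ∀ P : Finset α, P.card = 1 →
      ∃ A ∈ 𝒜, A.Nonempty ∧ (A ∩ P).card = (A ∩ Pᶜ).card) :
    Fintype.card α ≤ 2 * 𝒜.card := by
  have hcover : (Finset.univ : Finset α) ⊆ (𝒜.filter (fun A => A.card = 2)).biUnion id := by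
    intro x _
    obtain ⟨A, hA, hne, hbal⟩ := h {x} (Finset.card_singleton x)
    obtain ⟨hx, hcard⟩ := mem_and_card_eq_two_of_balanced_singleton hne hbal
    exact Finset.mem_biUnion.2 ⟨A, Finset.mem_filter.2 ⟨hA, hcard⟩, hx⟩
  calc Fintype.card α ≤ ((𝒜.filter (fun A => A.card = 2)).biUnion id).card :=
        Finset.card_le_card hcover
    _ ≤ (𝒜.filter (fun A => A.card = 2)).card * 2 :=
        Finset.card_biUnion_le_card_mul _ _ _ fun A hA => (Finset.mem_filter.1 hA).2.le
    _ ≤ 2 * 𝒜.card := by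
        have := Finset.card_filter_le 𝒜 (fun A => A.card = 2)
        omega

/-- The value `gammaGen n k₁ k₂ 2 n` is attained when only non-trivial bicolorings occur. -/
theorem gammaGen_attained {n k₁ k₂ : ℕ} (h₁ : 1 ≤ k₁) (h₂ : k₂ < n) :
    ∃ 𝒜 : Finset (Finset (Fin n)),
      𝒜.card = gammaGen n k₁ k₂ 2 n ∧
      (∀ A ∈ 𝒜, 2 ≤ A.card ∧ A.card ≤ n) ∧
      (∀ P : Finset (Fin n), k₁ ≤ P.card → P.card ≤ k₂ →
        ∃ A ∈ 𝒜, (A ∩ P).card = (A ∩ Pᶜ).card) := by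
  refine Nat.sInf_mem (s := {m | ∃ 𝒜 : Finset (Finset (Fin n)), 𝒜.card = m ∧
    (∀ A ∈ 𝒜, 2 ≤ A.card ∧ A.card ≤ n) ∧
    (∀ P : Finset (Fin n), k₁ ≤ P.card → P.card ≤ k₂ →
      ∃ A ∈ 𝒜, (A ∩ P).card = (A ∩ Pᶜ).card)})
    ⟨_, Finset.univ.filter (fun A => 2 ≤ A.card), rfl, fun A hA =>
      ⟨(Finset.mem_filter.1 hA).2, card_finset_fin_le A⟩, fun P hP₁ hP₂ => ?_⟩
  obtain ⟨p, hp⟩ : P.Nonempty := Finset.card_pos.1 (by omega)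
  obtain ⟨q, hq⟩ : Pᶜ.Nonempty := by
    apply Finset.card_pos.1
    rw [Finset.card_compl, Fintype.card_fin]
    omega
  have hq' : q ∉ P := Finset.mem_compl.1 hq
  have hpq : p ≠ q := fun h => hq' (h ▸ hp)
  refine ⟨{p, q}, Finset.mem_filter.2 ⟨Finset.mem_univ _, (Finset.card_pair hpq).ge⟩, ?_⟩
  have hP : ({p, q} : Finset (Fin n)) ∩ P = {p} := by
    rw [Finset.insert_inter_of_mem hp, Finset.singleton_inter_of_notMem hq', insert_empty_eq]
  have hPc : ({p, q} : Finset (Fin n)) ∩ Pᶜ = {q} := by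
    rw [Finset.insert_inter_of_notMem (by simpa using hp), Finset.singleton_inter_of_mem hq]
  rw [hP, hPc, Finset.card_singleton, Finset.card_singleton]

/-- Proposition (iv): `n/2 ≤ γ(n,1,[2,n]) ≤ γ(n,[1,n-k],[2,n])` for `1 ≤ k ≤ n-1`; in
particular, every system of unbiased representatives for the family of the `n` bicolorings
`B` of `[n]` with `|B(+1)| = 1` has cardinality at least `n/2`. -/
theorem stmt_4 (n k : ℕ) (hn : 2 ≤ n) (hk1 : 1 ≤ k) (hk2 : k ≤ n - 1) :
    (n : ℝ) / 2 ≤ (gammaGen n 1 1 2 n : ℝ) ∧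
    gammaGen n 1 1 2 n ≤ gammaGen n 1 (n - k) 2 n ∧
    ∀ 𝒜 : Finset (Finset (Fin n)),
      (∀ P : Finset (Fin n), P.card = 1 →
        ∃ A ∈ 𝒜, A.Nonempty ∧ (A ∩ P).card = (A ∩ Pᶜ).card) →
      (n : ℝ) / 2 ≤ (𝒜.card : ℝ) := by
  have hlower : ∀ 𝒜 : Finset (Finset (Fin n)),
      (∀ P : Finset (Fin n), P.card = 1 →
        ∃ A ∈ 𝒜, A.Nonempty ∧ (A ∩ P).card = (A ∩ Pᶜ).card) →
      (n : ℝ) / 2 ≤ (𝒜.card : ℝ) := by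
    intro 𝒜 h
    have hcard := card_le_two_mul_card_of_balances_singletons 𝒜 h
    rw [Fintype.card_fin] at hcard
    have hreal : (n : ℝ) ≤ 2 * (𝒜.card : ℝ) := by exact_mod_cast hcard
    linarith
  refine ⟨?_, ?_, hlower⟩
  · obtain ⟨𝒜, hcard, hsize, hrep⟩ := gammaGen_attained (n := n) (k₂ := 1) le_rfl (by omega)
    rw [← hcard]
    refine hlower 𝒜 fun P hP => ?_
    obtain ⟨A, hA, hbal⟩ := hrep P hP.ge hP.le
    exact ⟨A, hA, Finset.card_pos.1 (by have := (hsize A hA).1; omega), hbal⟩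
  · obtain ⟨𝒜, hcard, hsize, hrep⟩ :=
      gammaGen_attained (n := n) (k₂ := n - k) le_rfl (by omega)
    exact Nat.sInf_le ⟨𝒜, hcard, hsize, fun P hP₁ hP₂ => hrep P hP₁ (by omega)⟩
end

section
/- Let 𝔽 be a field, let F ∈ 𝔽[x₁,…,xₙ] be a polynomial, and let S₁,…,Sₙ be non-empty finite subsets of 𝔽. Suppose there is a point (s₁,…,sₙ) ∈ S₁ × ⋯ × Sₙ such that F(s₁,…,sₙ) ≠ 0 while F vanishes at every other point of S₁ × ⋯ × Sₙ. Then the total degree of F satisfies deg(F) ≥ Σᵢ₌₁ⁿ (|Sᵢ| − 1). -/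
open MvPolynomial in
theorem MvPolynomial.coeff_prod_prod_X_sub_C {R σ : Type*} [CommRing R] [Nontrivial R]
    [Fintype σ] (T : σ → Finset R) (t : σ →₀ ℕ) (ht : ∀ i, t i = (T i).card) :
    coeff t (∏ i, ∏ r ∈ T i, (X i - C r)) = 1 := by
  let _ : LinearOrder σ := WellOrderingRel.isWellOrder.linearOrder
  let m : MonomialOrder σ := MonomialOrder.degLex
  have hmonic (i : σ) : m.Monic (∏ r ∈ T i, (X i - C r)) :=
    MonomialOrder.Monic.prod fun r _ ↦ m.monic_X_sub_C i r
  have hdeg (i : σ) : m.degree (∏ r ∈ T i, (X i - C r)) = Finsupp.single i (T i).card := by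
    rw [MonomialOrder.degree_prod_of_regular]
    · simp [Finset.sum_congr rfl (fun r _ ↦ m.degree_X_sub_C i r)]
    · intro r _
      rw [m.monic_X_sub_C]
      exact isRegular_one
  have hdeg' : m.degree (∏ i, ∏ r ∈ T i, (X i - C r)) = t := by
    rw [MonomialOrder.degree_prod_of_regular]
    · simp only [hdeg, ← ht]
      exact Finsupp.univ_sum_single t
    · intro i _
      rw [hmonic i]
      exact isRegular_one
  have h : m.Monic (∏ i, ∏ r ∈ T i, (X i - C r)) :=
    MonomialOrder.Monic.prod fun i _ ↦ hmonic i
  rw [MonomialOrder.Monic, MonomialOrder.leadingCoeff, hdeg'] at h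
  exact h

open MvPolynomial in
theorem MvPolynomial.totalDegree_prod_prod_X_sub_C_le {R σ : Type*} [CommRing R] [Nontrivial R]
    [Fintype σ] (T : σ → Finset R) :
    (∏ i, ∏ r ∈ T i, (X i - C r) : MvPolynomial σ R).totalDegree ≤ ∑ i, (T i).card := by
  refine (totalDegree_finsetProd _ _).trans (Finset.sum_le_sum fun i _ ↦ ?_)
  refine (totalDegree_finsetProd _ _).trans ?_
  rw [Finset.card_eq_sum_ones]
  refine Finset.sum_le_sum fun r _ ↦ (totalDegree_sub_C_le _ _).trans ?_
  rw [totalDegree_X]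

/-- Lemma (via the Combinatorial Nullstellensatz): if a polynomial `F` over a field vanishes
at every point of a finite grid `S 0 × ⋯ × S (n-1)` except at a single point `s` of the grid,
then the total degree of `F` is at least `Σ i, (|S i| - 1)`. -/
theorem stmt_5 {F : Type*} [Field F] (n : ℕ) (P : MvPolynomial (Fin n) F)
    (S : Fin n → Finset F) (hS : ∀ i, (S i).Nonempty)
    (s : Fin n → F) (hs : ∀ i, s i ∈ S i)
    (hne : MvPolynomial.eval s P ≠ 0)
    (hvanish : ∀ t : Fin n → F, (∀ i, t i ∈ S i) → t ≠ s → MvPolynomial.eval t P = 0) :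
    ∑ i, ((S i).card - 1) ≤ P.totalDegree := by
  classical
  open MvPolynomial in
  by_contra! hlt
  let T (i : Fin n) : Finset F := (S i).erase (s i)
  have hT (i : Fin n) : (T i).card = (S i).card - 1 := Finset.card_erase_of_mem (hs i)
  let G : MvPolynomial (Fin n) F := ∏ i, ∏ r ∈ T i, (X i - C r)
  let t : Fin n →₀ ℕ := Finsupp.equivFunOnFinite.symm fun i ↦ (S i).card - 1
  have ht : t.degree = ∑ i, ((S i).card - 1) := Finsupp.degree_eq_sum t
  let H : MvPolynomial (Fin n) F := C (eval s P) * G - C (eval s G) * P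
  have hPt : coeff t P = 0 := by
    refine coeff_eq_zero_of_totalDegree_lt ?_
    change _ < t.degree
    rwa [ht]
  have hGt : coeff t G = 1 := coeff_prod_prod_X_sub_C T t fun i ↦ (hT i).symm
  have hHt : coeff t H ≠ 0 := by
    simpa [H, coeff_C_mul, hPt, hGt] using hne
  have hG : G.totalDegree ≤ t.degree := by
    rw [ht, ← Finset.sum_congr rfl fun i _ ↦ hT i]
    exact totalDegree_prod_prod_X_sub_C_le T
  have hC (a : F) (Q : MvPolynomial (Fin n) F) : (C a * Q).totalDegree ≤ Q.totalDegree := by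
    simpa using totalDegree_mul (C a) Q
  have hH : H.totalDegree = t.degree := by
    refine le_antisymm ?_ (le_totalDegree (mem_support_iff.mpr hHt))
    refine (totalDegree_sub _ _).trans (max_le ((hC _ _).trans hG) ((hC _ _).trans ?_))
    rw [ht]
    exact hlt.le
  obtain ⟨x, hx, hxH⟩ := combinatorial_nullstellensatz_exists_eval_nonzero H t hHt hH S
    fun i ↦ Nat.sub_lt (hS i).card_pos one_pos
  apply hxH
  by_cases hxs : x = s
  · simp [H, hxs, mul_comm]
  · obtain ⟨i, hi⟩ := Function.ne_iff.mp hxs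
    have hGx : eval x G = 0 := by
      simp only [G, map_prod]
      refine Finset.prod_eq_zero (Finset.mem_univ i) ?_
      exact Finset.prod_eq_zero (Finset.mem_erase.mpr ⟨hi, hx i⟩) (by simp)
    simp [H, hGx, hvanish x hx hxs]
end

section
/- Let ℬ be a family of non-trivial bicolorings of [n] and let 𝒞 = {B(+1) : B ∈ ℬ} ∪ {B(−1) : B ∈ ℬ}. Let H ⊆ [n] be a hitting set for 𝒞 with |H| ≥ 2, fix h₁ ∈ H, and define 𝒜 = { {h₁, h} : h ∈ H, h ≠ h₁ }. Then 𝒜 is a system of unbiased representatives for ℬ of cardinality |H| − 1; i.e., for every B ∈ ℬ there exists h ∈ H, h ≠ h₁, such that one of h₁, h lies in B(+1) and the other lies in B(−1). -/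
/-- Lemma 2: let `ℬ` be a family of non-trivial bicolorings of `[n]` (each given by its
`+1`-class `P`), and let `H` be a hitting set for the family consisting of all classes
`B(+1)` and `B(-1)`, `B ∈ ℬ`.  Fix `h₁ ∈ H`.  Then the family of pairs `{h₁,h}`,
`h ∈ H \ {h₁}`, is a system of unbiased representatives for `ℬ` of cardinality `|H| - 1`:
for every `B ∈ ℬ` there is `h ∈ H`, `h ≠ h₁`, with one of `h₁, h` in `B(+1)` and the
other in `B(-1)`. -/
theorem stmt_6 (n : ℕ) (ℬ : Set (Finset (Fin n)))
    (hnt : ∀ P ∈ ℬ, P.Nonempty ∧ Pᶜ.Nonempty)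
    (H : Finset (Fin n)) (h₁ : Fin n) (hh₁ : h₁ ∈ H) (hHcard : 2 ≤ H.card)
    (hhit : ∀ P ∈ ℬ, (H ∩ P).Nonempty ∧ (H ∩ Pᶜ).Nonempty) :
    ((H.erase h₁).image (fun h => ({h₁, h} : Finset (Fin n)))).card = H.card - 1 ∧
    ∀ P ∈ ℬ, ∃ h ∈ H, h ≠ h₁ ∧
      ((h₁ ∈ P ∧ h ∈ Pᶜ) ∨ (h₁ ∈ Pᶜ ∧ h ∈ P)) := by
  constructor
  · rw [Finset.card_image_of_injOn, Finset.card_erase_of_mem hh₁]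
    intro a ha b hb hab
    have ha' : a ≠ h₁ := Finset.ne_of_mem_erase ha
    have hmem : a ∈ ({h₁, b} : Finset (Fin n)) := by
      have hpair : ({h₁, a} : Finset (Fin n)) = {h₁, b} := hab
      rw [← hpair]
      simp
    simpa [ha'] using hmem
  · intro P hP
    obtain ⟨⟨x, hx⟩, ⟨y, hy⟩⟩ := hhit P hP
    rw [Finset.mem_inter] at hx hy
    by_cases h : h₁ ∈ P
    · exact ⟨y, hy.1, fun e => Finset.mem_compl.mp hy.2 (e ▸ h), Or.inl ⟨h, hy.2⟩⟩
    · exact ⟨x, hx.1, fun e => h (e ▸ hx.2), Or.inr ⟨Finset.mem_compl.mpr h, hx.2⟩⟩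
end

section
/- Let n be an integer and let r, k ∈ [n] with r even and 2 ≤ r ≤ 2k. Then C(n,k) / (C(r,r/2) · C(n−r, k−r/2)) ≤ γ(n,k,r) ≤ (C(n,k) / (C(r,r/2) · C(n−r, k−r/2))) · (1 + 0.7r + ln C(n−r, k−r/2)), where C(a,b) denotes the binomial coefficient. -/
/-- `gammaE n k r` is the minimum cardinality of a family of `r`-element subsets of `[n]`
such that every `k`-bicoloring `B` of `[n]` (identified with its `+1`-class `P`, `|P| = k`)
has an unbiased representative in the family, i.e. some member `A` with
`|A ∩ B(+1)| = |A ∩ B(-1)|`. -/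
noncomputable def gammaE (n k r : ℕ) : ℕ :=
  sInf {m | ∃ 𝒜 : Finset (Finset (Fin n)),
    𝒜.card = m ∧
    (∀ A ∈ 𝒜, A.card = r) ∧
    (∀ P : Finset (Fin n), P.card = k →
      ∃ A ∈ 𝒜, (A ∩ P).card = (A ∩ Pᶜ).card)}

open Finset in
/-- The number of `m`-sets meeting `S` in exactly `h` elements. -/
lemma card_filter_card_inter_eq {n : ℕ} (S : Finset (Fin n)) (m h : ℕ) (hm : h ≤ m) :
    #{T ∈ powersetCard m (univ : Finset (Fin n)) | #(T ∩ S) = h} =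
      (#S).choose h * (n - #S).choose (m - h) := by
  have hc : #Sᶜ = n - #S := by rw [card_compl, Fintype.card_fin]
  rw [← hc, ← card_powersetCard, ← card_powersetCard, ← card_product]
  refine card_bij' (fun T _ => (T ∩ S, T ∩ Sᶜ)) (fun p _ => p.1 ∪ p.2) ?_ ?_ ?_ ?_
  · intro T hT
    simp only [mem_filter, mem_powersetCard, subset_univ, true_and] at hT
    have := card_inter_add_card_sdiff T S
    rw [sdiff_eq_inter_compl] at this
    simp only [mem_product, mem_powersetCard, inter_subset_right, true_and]
    omega
  · rintro ⟨A, B⟩ hp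
    simp only [mem_product, mem_powersetCard] at hp
    obtain ⟨⟨hA, hAc⟩, hB, hBc⟩ := hp
    have hBS : Disjoint B S := disjoint_left.2 fun x hx => by simpa using hB hx
    have hd : Disjoint A B := (hBS.mono_right hA).symm
    simp only [mem_filter, mem_powersetCard, subset_univ, true_and]
    refine ⟨by rw [card_union_of_disjoint hd]; omega, ?_⟩
    rw [union_inter_distrib_right, inter_eq_left.2 hA, disjoint_iff_inter_eq_empty.1 hBS,
      union_empty, hAc]
  · intro T _
    simp only
    rw [← inter_union_distrib_left, union_compl, inter_univ]
  · rintro ⟨A, B⟩ hp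
    simp only [mem_product, mem_powersetCard] at hp
    obtain ⟨⟨hA, _⟩, hB, _⟩ := hp
    ext x
    · have h1 := @hA x
      have h2 := @hB x
      simp only [mem_compl] at h2
      simp only [mem_inter, mem_union]
      tauto
    · have h1 := @hA x
      have h2 := @hB x
      simp only [mem_compl] at h2
      simp only [mem_inter, mem_union, mem_compl]
      tauto

open Finset in
/-- The inductive form of the Lovász–Stein theorem: a set `U` of points, each lying on at least
`D` of the members of `E`, and met by each member in at most `t + 1` points, has a small cover. -/
lemma exists_cover_of_card_filter_le {α β : Type*} [DecidableEq α] [DecidableEq β]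
    (R : α → β → Prop) [∀ x e, Decidable (R x e)] (E : Finset β) (D : ℕ) (hD : 0 < D) (t : ℕ) :
    ∀ U : Finset α, (∀ x ∈ U, D ≤ #{e ∈ E | R x e}) → (∀ e ∈ E, #{x ∈ U | R x e} ≤ t + 1) →
      ∃ C ⊆ E, (∀ x ∈ U, ∃ e ∈ C, R x e) ∧
        (#C : ℝ) ≤ #U / (t + 1) + (#E : ℝ) / D * (harmonic (t + 1) - 1) := by
  induction t with
  | zero =>
    intro U hU _
    have hex : ∀ x ∈ U, ∃ e ∈ E, R x e := fun x hx => by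
      obtain ⟨e, he⟩ := card_pos.1 (hD.trans_le (hU x hx))
      exact ⟨e, (mem_filter.1 he).1, (mem_filter.1 he).2⟩
    choose f hfE hfR using hex
    refine ⟨U.attach.image fun x => f x.1 x.2, image_subset_iff.2 fun x _ => hfE x.1 x.2,
      fun x hx => ⟨f x hx, mem_image.2 ⟨⟨x, hx⟩, mem_attach _ _, rfl⟩, hfR x hx⟩, ?_⟩
    have : (#(U.attach.image fun x => f x.1 x.2) : ℝ) ≤ #U := by
      exact_mod_cast card_image_le.trans card_attach.le
    simpa [harmonic] using this
  | succ t ih =>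
    intro U
    induction U using Finset.strongInduction with
    | H U ihU =>
      intro hU hE
      by_cases hmax : ∀ e ∈ E, #{x ∈ U | R x e} ≤ t + 1
      · obtain ⟨C, hCE, hC, hcard⟩ := ih U hU hmax
        refine ⟨C, hCE, hC, hcard.trans ?_⟩
        have hcount : #U * D ≤ #E * (t + 1) := card_mul_le_card_mul R hU hmax
        have hcount' : (#U : ℝ) * D ≤ #E * (t + 1) := by exact_mod_cast hcount
        have hD' : (0 : ℝ) < D := by exact_mod_cast hD
        have hq : (#U : ℝ) ≤ (#E : ℝ) / D * (t + 1) := by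
          rw [div_mul_eq_mul_div, le_div_iff₀ hD']
          exact hcount'
        rw [harmonic_succ (t + 1)]
        push_cast
        generalize (#E : ℝ) / D = c at hq ⊢
        have ht1 : (0 : ℝ) < t + 1 := by positivity
        have ht2 : (0 : ℝ) < (t : ℝ) + 1 + 1 := by positivity
        have hdiff : (#U : ℝ) / (t + 1) - #U / (t + 1 + 1) ≤ c * ((t : ℝ) + 1 + 1)⁻¹ := by
          rw [div_sub_div _ _ ht1.ne' ht2.ne', ← div_eq_mul_inv,
            div_le_div_iff₀ (by positivity) ht2]
          nlinarith [mul_le_mul_of_nonneg_right hq ht2.le]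
        linarith
      · push Not at hmax
        obtain ⟨e, heE, he⟩ := hmax
        have hcard_e : #{x ∈ U | R x e} = t + 1 + 1 := le_antisymm (hE e heE) he
        have hsplit := card_filter_add_card_filter_not (s := U) (fun x => R x e)
        obtain ⟨C, hCE, hC, hcard⟩ := ihU {x ∈ U | ¬ R x e}
          (by
            refine ⟨filter_subset _ _, fun hsub => ?_⟩
            have := card_le_card hsub
            omega)
          (fun x hx => hU x (mem_filter.1 hx).1)
          (fun e' he' => (card_le_card (filter_subset_filter _ (filter_subset _ _))).trans
            (hE e' he'))
        refine ⟨insert e C, insert_subset heE hCE, fun x hx => ?_, ?_⟩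
        · by_cases hxe : R x e
          · exact ⟨e, mem_insert_self _ _, hxe⟩
          · obtain ⟨e', he', hR⟩ := hC x (mem_filter.2 ⟨hx, hxe⟩)
            exact ⟨e', mem_insert_of_mem he', hR⟩
        · have h1 : (#(insert e C) : ℝ) ≤ #C + 1 := by exact_mod_cast card_insert_le e C
          have h2 : (#U : ℝ) = (t + 1 + 1) + #{x ∈ U | ¬ R x e} := by
            rw [← hsplit, hcard_e]
            push_cast
            ring
          have ht2 : (t : ℝ) + 1 + 1 ≠ 0 := by positivity
          rw [h2]
          push_cast at hcard ⊢
          rw [add_div, div_self ht2]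
          linarith

open Finset in
/-- The Lovász–Stein covering theorem. -/
lemma exists_cover_card_le {α β : Type*} [DecidableEq α] [DecidableEq β]
    (R : α → β → Prop) [∀ x e, Decidable (R x e)] (V : Finset α) (E : Finset β) (D a : ℕ)
    (hD : 0 < D) (ha : 0 < a) (hV : ∀ x ∈ V, D ≤ #{e ∈ E | R x e})
    (hE : ∀ e ∈ E, #{x ∈ V | R x e} ≤ a) :
    ∃ C ⊆ E, (∀ x ∈ V, ∃ e ∈ C, R x e) ∧ (#C : ℝ) ≤ (#E : ℝ) / D * (1 + Real.log a) := by
  obtain ⟨t, rfl⟩ : ∃ t, a = t + 1 := ⟨a - 1, by omega⟩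
  obtain ⟨C, hCE, hC, hcard⟩ := exists_cover_of_card_filter_le R E D hD t V hV hE
  refine ⟨C, hCE, hC, hcard.trans ?_⟩
  have hcount : (#V : ℝ) * D ≤ #E * (t + 1) := by exact_mod_cast card_mul_le_card_mul R hV hE
  have hD' : (0 : ℝ) < D := by exact_mod_cast hD
  have hq : (#V : ℝ) / (t + 1) ≤ (#E : ℝ) / D := by
    rw [div_le_div_iff₀ (by positivity) hD']
    exact hcount
  have hH := mul_le_mul_of_nonneg_left (harmonic_le_one_add_log (t + 1))
    (by positivity : (0 : ℝ) ≤ (#E : ℝ) / D)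
  linarith

lemma log_choose_le (r h : ℕ) : Real.log (r.choose h) ≤ 0.7 * r := by
  rcases Nat.eq_zero_or_pos (r.choose h) with h0 | hpos
  · rw [h0]
    simp only [Nat.cast_zero, Real.log_zero]
    positivity
  have hle : (r.choose h : ℝ) ≤ 2 ^ r := by exact_mod_cast Nat.choose_le_two_pow r h
  have := Real.log_le_log (by exact_mod_cast hpos) hle
  rw [Real.log_pow] at this
  nlinarith [Real.log_two_lt_d9, (Nat.cast_nonneg r : (0 : ℝ) ≤ r)]

open Finset in
lemma card_inter_eq_card_inter_compl_iff {n : ℕ} {A : Finset (Fin n)} (P : Finset (Fin n)) {h : ℕ}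
    (hA : #A = h + h) : #(A ∩ P) = #(A ∩ Pᶜ) ↔ #(A ∩ P) = h := by
  have := card_inter_add_card_sdiff A P
  rw [sdiff_eq_inter_compl] at this
  omega

/-- Theorem 5: for `r, k ∈ [n]` with `r` even and `2 ≤ r ≤ 2k`,
`C(n,k)/(C(r,r/2) C(n-r,k-r/2)) ≤ γ(n,k,r)
  ≤ (C(n,k)/(C(r,r/2) C(n-r,k-r/2))) (1 + 0.7 r + ln C(n-r,k-r/2))`. -/
theorem stmt_12 (n k r : ℕ) (hk1 : 1 ≤ k) (hkn : k ≤ n) (hr1 : 1 ≤ r) (hrn : r ≤ n)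
    (hr : Even r) (hr2 : 2 ≤ r) (hrk : r ≤ 2 * k) :
    (n.choose k : ℝ) / ((r.choose (r / 2) : ℝ) * ((n - r).choose (k - r / 2) : ℝ)) ≤
      (gammaE n k r : ℝ) ∧
    (gammaE n k r : ℝ) ≤
      (n.choose k : ℝ) / ((r.choose (r / 2) : ℝ) * ((n - r).choose (k - r / 2) : ℝ)) *
        (1 + 0.7 * (r : ℝ) + Real.log ((n - r).choose (k - r / 2) : ℝ)) := by
  obtain ⟨h, rfl⟩ := hr
  have hh : (h + h) / 2 = h := by omega
  rw [hh]
  have hhk : h ≤ k := by omega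
  have hrep : ∀ P : Finset (Fin n), P.card = k →
      ((Finset.powersetCard (h + h) Finset.univ).filter
        fun A => (A ∩ P).card = (A ∩ Pᶜ).card).card = k.choose h * (n - k).choose h := by
    intro P hP
    have := card_filter_card_inter_eq P (h + h) h (by omega)
    rw [hP, Nat.add_sub_cancel] at this
    rw [← this]
    congr 1
    exact Finset.filter_congr fun A hA =>
      card_inter_eq_card_inter_compl_iff P (Finset.mem_powersetCard.1 hA).2
  have hcov : ∀ A : Finset (Fin n), A.card = h + h →
      ((Finset.powersetCard k Finset.univ).filter
        fun P => (A ∩ P).card = (A ∩ Pᶜ).card).card =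
          (h + h).choose h * (n - (h + h)).choose (k - h) := by
    intro A hA
    have := card_filter_card_inter_eq A k h hhk
    rw [hA] at this
    rw [← this]
    congr 1
    refine Finset.filter_congr fun P _ => ?_
    rw [card_inter_eq_card_inter_compl_iff P hA, Finset.inter_comm]
  have hVcard : (Finset.powersetCard k (Finset.univ : Finset (Fin n))).card = n.choose k := by simp
  set S : Set ℕ := {m | ∃ 𝒜 : Finset (Finset (Fin n)), 𝒜.card = m ∧
    (∀ A ∈ 𝒜, A.card = h + h) ∧
    (∀ P : Finset (Fin n), P.card = k → ∃ A ∈ 𝒜, (A ∩ P).card = (A ∩ Pᶜ).card)} with hS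
  have hgamma : gammaE n k (h + h) = sInf S := rfl
  have ha1 : 0 < (h + h).choose h := Nat.choose_pos (by omega)
  rcases Nat.lt_or_ge (n - k) h with hlt | hge
  · have hempty : S = ∅ := by
      refine Set.eq_empty_iff_forall_notMem.2 ?_
      rintro m ⟨𝒜, -, hr𝒜, h𝒜⟩
      obtain ⟨P, -, hP⟩ := Finset.exists_subset_card_eq
        (s := (Finset.univ : Finset (Fin n))) (n := k) (by simpa using hkn)
      obtain ⟨A, hA, hAP⟩ := h𝒜 P hP
      have hpos : 0 < k.choose h * (n - k).choose h := by
        rw [← hrep P hP]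
        exact Finset.card_pos.2 ⟨A, by simp [hr𝒜 A hA, hAP]⟩
      rw [Nat.choose_eq_zero_of_lt hlt] at hpos
      omega
    have hz : (n - (h + h)).choose (k - h) = 0 := Nat.choose_eq_zero_of_lt (by omega)
    simp [hgamma, hempty, hz]
  have ha2 : 0 < (n - (h + h)).choose (k - h) := Nat.choose_pos (by omega)
  have hD : 0 < k.choose h * (n - k).choose h :=
    Nat.mul_pos (Nat.choose_pos hhk) (Nat.choose_pos hge)
  obtain ⟨C, hCE, hC, hcard⟩ := exists_cover_card_le
    (fun P A : Finset (Fin n) => (A ∩ P).card = (A ∩ Pᶜ).card)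
    (Finset.powersetCard k Finset.univ) (Finset.powersetCard (h + h) Finset.univ)
    _ _ hD (Nat.mul_pos ha1 ha2)
    (fun P hP => (hrep P (Finset.mem_powersetCard.1 hP).2).ge)
    (fun A hA => (hcov A (Finset.mem_powersetCard.1 hA).2).le)
  have hCS : C.card ∈ S := ⟨C, rfl, fun A hA => (Finset.mem_powersetCard.1 (hCE hA)).2,
    fun P hP => hC P (by simp [hP])⟩
  have ha1' : (0 : ℝ) < (h + h).choose h := by exact_mod_cast ha1
  have ha2' : (0 : ℝ) < (n - (h + h)).choose (k - h) := by exact_mod_cast ha2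
  have hD' : (0 : ℝ) < (k.choose h * (n - k).choose h : ℕ) := by exact_mod_cast hD
  constructor
  · obtain ⟨𝒜, hm, hr𝒜, h𝒜⟩ := Nat.sInf_mem ⟨_, hCS⟩
    rw [hgamma, ← hm, div_le_iff₀ (mul_pos ha1' ha2')]
    have hcount := Finset.card_mul_le_card_mul
      (s := Finset.powersetCard k Finset.univ) (t := 𝒜) (m := 1)
      (fun P A : Finset (Fin n) => (A ∩ P).card = (A ∩ Pᶜ).card)
      (fun P hP => by
        obtain ⟨A, hA, hAP⟩ := h𝒜 P (Finset.mem_powersetCard.1 hP).2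
        exact Finset.card_pos.2 ⟨A, Finset.mem_filter.2 ⟨hA, hAP⟩⟩)
      (fun A hA => (hcov A (hr𝒜 A hA)).le)
    rw [hVcard, mul_one] at hcount
    exact_mod_cast hcount
  · have hcount := Finset.card_mul_eq_card_mul
      (s := Finset.powersetCard k Finset.univ) (t := Finset.powersetCard (h + h) Finset.univ)
      (fun P A : Finset (Fin n) => (A ∩ P).card = (A ∩ Pᶜ).card)
      (fun P hP => hrep P (Finset.mem_powersetCard.1 hP).2)
      (fun A hA => hcov A (Finset.mem_powersetCard.1 hA).2)
    rw [hVcard] at hcount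
    have hratio : ((Finset.powersetCard (h + h) (Finset.univ : Finset (Fin n))).card : ℝ) /
        (k.choose h * (n - k).choose h : ℕ) =
        (n.choose k : ℝ) / ((h + h).choose h * (n - (h + h)).choose (k - h)) := by
      rw [div_eq_div_iff hD'.ne' (mul_pos ha1' ha2').ne']
      exact_mod_cast hcount.symm
    rw [hratio, Nat.cast_mul, Real.log_mul ha1'.ne' ha2'.ne'] at hcard
    have hle : (gammaE n k (h + h) : ℝ) ≤ C.card := by exact_mod_cast Nat.sInf_le hCS
    refine hle.trans (hcard.trans (mul_le_mul_of_nonneg_left ?_ (by positivity)))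
    linarith [log_choose_le (h + h) h]
end

section
/- Let n be an even positive integer. Then ⌈n/4⌉ ≤ γ(n, n/2, 2) ≤ n/2; that is, every family of 2-element subsets of [n] that is a system of unbiased representatives for all n/2-bicolorings of [n] has cardinality at least ⌈n/4⌉, and the family 𝒜 = {{1,2},{1,3},…,{1,n/2+1}} of n/2 two-element sets is such a system of unbiased representatives. -/
/-- A family of pairs that hits every `k`-bicoloring has more than `k / 2` members: otherwise
some `k`-set contains all the pairs. -/
theorem lt_two_mul_card_of_unbiased {n k : ℕ} (hk : k ≤ n) {𝒜 : Finset (Finset (Fin n))}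
    (h2 : ∀ A ∈ 𝒜, A.card = 2)
    (h : ∀ P : Finset (Fin n), P.card = k → ∃ A ∈ 𝒜, (A ∩ P).card = (A ∩ Pᶜ).card) :
    k < 2 * 𝒜.card := by
  by_contra! hlt
  have hU : (𝒜.biUnion id).card ≤ k := by
    have := Finset.card_biUnion_le_card_mul 𝒜 id 2 (fun A hA => (h2 A hA).le)
    omega
  obtain ⟨P, hUP, hP⟩ := Finset.exists_superset_card_eq hU (by simpa using hk)
  obtain ⟨A, hA, hAP⟩ := h P hP
  have hsub : A ⊆ P := (Finset.subset_biUnion_of_mem id hA).trans hUP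
  have h0 : A ∩ Pᶜ = ∅ := by
    rw [← Finset.sdiff_eq_inter_compl, Finset.sdiff_eq_empty_iff_subset]
    exact hsub
  rw [h0, Finset.inter_eq_left.mpr hsub, h2 A hA] at hAP
  simp at hAP

/-- A pair whose points have different colors is unbiased. -/
theorem card_pair_inter_eq_of_mem_iff_notMem {α : Type*} [Fintype α] [DecidableEq α] {a b : α}
    {P : Finset α} (h : a ∈ P ↔ b ∉ P) :
    (({a, b} : Finset α) ∩ P).card = (({a, b} : Finset α) ∩ Pᶜ).card := by
  by_cases hb : b ∈ P
  · have ha : a ∉ P := fun ha => h.mp ha hb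
    simp [Finset.insert_inter_of_mem, Finset.insert_inter_of_notMem, ha, hb]
  · have ha : a ∈ P := h.mpr hb
    simp [Finset.insert_inter_of_mem, Finset.insert_inter_of_notMem, ha, hb]

/-- The star of pairs joining the first point to the next `n / 2` points hits every
balanced bicoloring. -/
theorem exists_unbiased_star_pair {n : ℕ} (hn : 0 < n) (he : Even n) (P : Finset (Fin n))
    (hP : P.card = n / 2) :
    ∃ i : Fin n, 0 < (i : ℕ) ∧ (i : ℕ) ≤ n / 2 ∧
      (({(⟨0, hn⟩ : Fin n), i} : Finset (Fin n)) ∩ P).card =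
        (({(⟨0, hn⟩ : Fin n), i} : Finset (Fin n)) ∩ Pᶜ).card := by
  have hn2 : 2 * (n / 2) = n := Nat.two_mul_div_two_of_even he
  by_contra! hcon
  have hsame : ∀ i ∈ Finset.Iic (⟨n / 2, by omega⟩ : Fin n), (⟨0, hn⟩ ∈ P ↔ i ∈ P) := by
    intro i hi
    rw [Finset.mem_Iic, Fin.le_def] at hi
    rcases Nat.eq_zero_or_pos (i : ℕ) with h0 | h0
    · rw [show i = ⟨0, hn⟩ from Fin.ext h0]
    · by_contra hne
      exact hcon i h0 hi (card_pair_inter_eq_of_mem_iff_notMem (by tauto))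
  by_cases hz : (⟨0, hn⟩ : Fin n) ∈ P
  · have := Finset.card_le_card fun i hi => (hsame i hi).mp hz
    rw [Fin.card_Iic] at this
    simp only at this
    omega
  · have := Finset.card_le_card fun i hi =>
      Finset.mem_compl.mpr fun hiP => hz ((hsame i hi).mpr hiP)
    rw [Fin.card_Iic, Finset.card_compl, Fintype.card_fin] at this
    simp only at this
    omega

/-- For `n` even and positive: `⌈n/4⌉ ≤ γ(n, n/2, 2) ≤ n/2`, and concretely the family of
the `n/2` pairs consisting of the first element of `Fin n` together with one of the next
`n/2` elements is a system of unbiased representatives for all `n/2`-bicolorings. -/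
theorem stmt_13 (n : ℕ) (hn : 0 < n) (he : Even n) :
    ((n + 3) / 4 ≤ gammaE n (n / 2) 2 ∧ gammaE n (n / 2) 2 ≤ n / 2) ∧
    ∀ P : Finset (Fin n), P.card = n / 2 →
      ∃ i : Fin n, 0 < (i : ℕ) ∧ (i : ℕ) ≤ n / 2 ∧
        ((({(⟨0, hn⟩ : Fin n), i} : Finset (Fin n)) ∩ P).card =
          (({(⟨0, hn⟩ : Fin n), i} : Finset (Fin n)) ∩ Pᶜ).card) := by
  have hn2 : 2 * (n / 2) = n := Nat.two_mul_div_two_of_even he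
  have hstar := exists_unbiased_star_pair hn he
  have hmem : n / 2 ∈ {m | ∃ 𝒜 : Finset (Finset (Fin n)), 𝒜.card = m ∧
      (∀ A ∈ 𝒜, A.card = 2) ∧
      (∀ P : Finset (Fin n), P.card = n / 2 →
        ∃ A ∈ 𝒜, (A ∩ P).card = (A ∩ Pᶜ).card)} := by
    refine ⟨(Finset.Ioc (⟨0, hn⟩ : Fin n) ⟨n / 2, by omega⟩).image fun i => {⟨0, hn⟩, i},
      ?_, ?_, ?_⟩
    · rw [Finset.card_image_of_injOn, Fin.card_Ioc]
      · simp
      · intro i hi j _ hij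
        have hi0 : i ≠ ⟨0, hn⟩ := (Finset.mem_Ioc.mp hi).1.ne'
        have : i ∈ ({⟨0, hn⟩, j} : Finset (Fin n)) := by
          rw [← show ({⟨0, hn⟩, i} : Finset (Fin n)) = {⟨0, hn⟩, j} from hij]
          simp
        simpa [hi0] using this
    · intro A hA
      obtain ⟨i, hi, rfl⟩ := Finset.mem_image.mp hA
      exact Finset.card_pair (Finset.mem_Ioc.mp hi).1.ne
    · intro P hP
      obtain ⟨i, h0, hi, h⟩ := hstar P hP
      exact ⟨_, Finset.mem_image_of_mem _ (Finset.mem_Ioc.mpr ⟨h0, hi⟩), h⟩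
  refine ⟨⟨le_csInf ⟨_, hmem⟩ ?_, Nat.sInf_le hmem⟩, hstar⟩
  rintro m ⟨𝒜, rfl, h2, h⟩
  have := lt_two_mul_card_of_unbiased (Nat.div_le_self n 2) h2 h
  omega
end

section
/- Let n, k be positive integers with 2k ≤ n, and let B and D be two distinct k-bicolorings of [n]. If S ⊆ [n] is a set of cardinality 2k that is an unbiased representative for both B and D (i.e., |S ∩ B(+1)| = |S ∩ B(−1)| and |S ∩ D(+1)| = |S ∩ D(−1)|), then B(+1) ∪ D(+1) ⊆ S. -/
/-- A set that meets `P` and its complement equally often, and has twice as many elements as `P`,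
contains `P`. -/
theorem subset_of_card_inter_eq_card_inter_compl {α : Type*} [Fintype α] [DecidableEq α]
    {P S : Finset α} (hS : S.card = 2 * P.card) (h : (S ∩ P).card = (S ∩ Pᶜ).card) :
    P ⊆ S := by
  have hsum := Finset.card_inter_add_card_sdiff S P
  rw [Finset.sdiff_eq_inter_compl] at hsum
  exact Finset.inter_eq_right.mp
    (Finset.eq_of_subset_of_card_le Finset.inter_subset_right (by omega))

/-- Key structural lemma: if `2k ≤ n`, `B` and `D` are two distinct `k`-bicolorings of `[n]`
(given by their `+1`-classes `P` and `D`, both of size `k`), and `S` is a `2k`-element set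
that is an unbiased representative for both, then `B(+1) ∪ D(+1) ⊆ S`. -/
theorem stmt_15 (n k : ℕ) (hk : 0 < k) (h2k : 2 * k ≤ n)
    (P D : Finset (Fin n)) (hP : P.card = k) (hD : D.card = k) (hPD : P ≠ D)
    (S : Finset (Fin n)) (hS : S.card = 2 * k)
    (h1 : (S ∩ P).card = (S ∩ Pᶜ).card)
    (h2 : (S ∩ D).card = (S ∩ Dᶜ).card) :
    P ∪ D ⊆ S := by
  exact Finset.union_subset
    (subset_of_card_inter_eq_card_inter_compl (hP.symm ▸ hS) h1)
    (subset_of_card_inter_eq_card_inter_compl (hD.symm ▸ hS) h2)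
end

section
/- For every ε with 0 < ε < 0.5 there exists a real constant δ = δ(ε) > 0 such that the following holds: for all positive integers n, every odd integer c with 1 ≤ c ≤ n/2, r = 2c, and every even integer k with εn < k < (1−ε)n, one has γ(n,k,r) ≥ δn; i.e., every family of r-element subsets of [n] that is a system of unbiased representatives for all k-bicolorings of [n] has cardinality at least δn. -/
open Finset Matrix

section CharTwo

variable {κ ι : Type*} [Fintype κ] [Fintype ι] [DecidableEq κ]

theorem ZMod.eq_one_of_ne_zero_two {x : ZMod 2} (h : x ≠ 0) : x = 1 := by
  revert x; decide

/-- A function on `(ZMod 2)^κ` that is invariant under a nonzero translation sums to zero. -/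
theorem sum_eq_zero_of_translation_invariant (g : (κ → ZMod 2) → ZMod 2) (μ : κ → ZMod 2)
    (hμ : μ ≠ 0) (hg : ∀ l, g (l + μ) = g l) : ∑ l, g l = 0 := by
  refine Finset.sum_involution (fun l _ => l + μ) ?_ ?_ ?_ ?_
  · intro l _
    rw [hg, CharTwo.add_self_eq_zero]
  · intro l _ _ h
    exact hμ (by simpa using h)
  · simp
  · intro l _
    funext t
    simp [add_assoc, CharTwo.add_self_eq_zero]

theorem sum_prod_vecMul_eq_zero (A : Matrix κ ι (ZMod 2)) (S : Finset ι)
    (hS : S.card < Fintype.card κ) : ∑ l : κ → ZMod 2, ∏ t ∈ S, (l ᵥ* A) t = 0 := by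
  have hker := LinearMap.ker_ne_bot_of_finrank_lt
    (f := (LinearMap.funLeft (ZMod 2) (ZMod 2) (Subtype.val : S → ι)).comp A.vecMulLinear)
    (by simpa using hS)
  obtain ⟨μ, hμ, hμ0⟩ := Submodule.exists_mem_ne_zero_of_ne_bot hker
  refine sum_eq_zero_of_translation_invariant _ μ hμ0 fun l => prod_congr rfl fun t ht => ?_
  have : (μ ᵥ* A) t = 0 := congrFun (LinearMap.mem_ker.mp hμ) ⟨t, ht⟩
  rw [add_vecMul, Pi.add_apply, this, add_zero]

theorem sum_prod_vecMul_eq_det (M : Matrix κ κ (ZMod 2)) :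
    ∑ l : κ → ZMod 2, ∏ t, (l ᵥ* M) t = M.det := by
  by_cases h : M.det = 0
  · obtain ⟨μ, hμ0, hμ⟩ := Matrix.exists_vecMul_eq_zero_iff.mpr h
    rw [h]
    refine sum_eq_zero_of_translation_invariant _ μ hμ0 fun l => ?_
    rw [add_vecMul, hμ, add_zero]
  · have hu : IsUnit M := (Matrix.isUnit_iff_isUnit_det M).mpr (isUnit_iff_ne_zero.mpr h)
    have hb : Function.Bijective fun l : κ → ZMod 2 => l ᵥ* M :=
      Finite.injective_iff_bijective.mp (Matrix.vecMul_injective_of_isUnit hu)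
    rw [ZMod.eq_one_of_ne_zero_two h,
      hb.sum_comp fun y : κ → ZMod 2 => ∏ t, y t]
    have := Finset.prod_univ_sum (fun _ : κ => (univ : Finset (ZMod 2))) fun _ b => b
    rw [Fintype.piFinset_univ] at this
    rw [← this]
    exact Finset.prod_eq_one fun _ _ => by decide

theorem sum_perm_prod_eq_det (M : Matrix κ κ (ZMod 2)) :
    ∑ σ : Equiv.Perm κ, ∏ i, M i (σ i) = M.det := by
  rw [← det_transpose, det_apply]
  refine sum_congr rfl fun σ _ => ?_
  rcases Int.units_eq_one_or (Equiv.Perm.sign σ) with h | h <;>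
    simp [h, Matrix.transpose_apply, CharTwo.neg_eq]

/-- Cauchy–Binet over `ZMod 2`, for the product of a matrix with its transpose. -/
theorem det_mul_transpose_eq_sum (A : Matrix κ ι (ZMod 2)) :
    (A * Aᵀ).det = ∑ S ∈ powersetCard (Fintype.card κ) (univ : Finset ι),
      ∑ l : κ → ZMod 2, ∏ t ∈ S, (l ᵥ* A) t := by
  classical
  have expand : (A * Aᵀ).det =
      ∑ f : κ → ι, (∏ i, A i (f i)) * (Matrix.of fun i j => A j (f i)).det := by
    have h1 : A * Aᵀ = fun i => ∑ t, A i t • fun j => A j t := by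
      ext i j
      simp [Matrix.mul_apply, Finset.sum_apply]
    rw [h1]
    have h2 := (detRowAlternating (n := κ) (R := ZMod 2)).toMultilinearMap.map_sum
      (fun i (t : ι) => A i t • fun j => A j t)
    refine h2.trans (sum_congr rfl fun f _ => ?_)
    exact MultilinearMap.map_smul_univ _ _ _
  rw [expand, ← Finset.sum_filter_of_ne (p := Function.Injective)]
  swap
  · intro f _ hf
    by_contra hinj
    obtain ⟨i, j, hij, hne⟩ : ∃ i j, f i = f j ∧ i ≠ j := by
      simpa [Function.Injective] using hinj
    exact hf (by rw [det_zero_of_row_eq hne (by ext k; simp [hij]), mul_zero])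
  rw [← Finset.sum_fiberwise_of_maps_to (g := fun f : κ → ι => univ.image f)
    (t := powersetCard (Fintype.card κ) univ)]
  swap
  · intro f hf
    rw [mem_powersetCard]
    exact ⟨subset_univ _, card_image_of_injective _ (mem_filter.mp hf).2⟩
  refine sum_congr rfl fun S hS => ?_
  have hcard : Fintype.card κ = Fintype.card S := by
    rw [Fintype.card_coe, (mem_powersetCard.mp hS).2]
  let e : κ ≃ S := Fintype.equivOfCardEq hcard
  let M : Matrix κ κ (ZMod 2) := A.submatrix id fun i => (e i : ι)
  have hR : ∑ l : κ → ZMod 2, ∏ t ∈ S, (l ᵥ* A) t = M.det := by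
    rw [← sum_prod_vecMul_eq_det]
    refine sum_congr rfl fun l _ => ?_
    rw [← Finset.prod_coe_sort, ← e.prod_comp]
    rfl
  have hL : ∑ σ : Equiv.Perm κ, (∏ i, M i (σ i)) * M.det = M.det := by
    rw [← sum_mul, sum_perm_prod_eq_det]
    generalize M.det = d
    revert d; decide
  rw [hR, ← hL]
  symm
  refine sum_bij (fun σ _ i => (e (σ i) : ι)) ?_ ?_ ?_ ?_
  · intro σ _
    have hinj : Function.Injective fun i => (e (σ i) : ι) :=
      Subtype.val_injective.comp (e.injective.comp σ.injective)
    simp only [mem_filter, mem_univ, true_and]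
    refine ⟨hinj, Finset.eq_of_subset_of_card_le ?_ ?_⟩
    · intro t ht
      obtain ⟨i, _, rfl⟩ := mem_image.mp ht
      exact (e (σ i)).2
    · rw [card_image_of_injective _ hinj, (mem_powersetCard.mp hS).2, card_univ]
  · intro σ _ τ _ h
    ext i
    exact e.injective (Subtype.ext (congrFun h i))
  · intro f hf
    simp only [mem_filter, mem_univ, true_and] at hf
    obtain ⟨hinj, him⟩ := hf
    have hmem : ∀ i, f i ∈ S := fun i => him ▸ mem_image_of_mem f (mem_univ i)
    let p : κ → κ := fun i => e.symm ⟨f i, hmem i⟩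
    have hp : Function.Injective p := fun i j h =>
      hinj (congrArg Subtype.val (e.symm.injective h))
    exact ⟨Equiv.ofBijective p (Finite.injective_iff_bijective.mp hp), mem_univ _, by
      ext i; simp [p]⟩
  · intro σ _
    congr 1
    have : (Matrix.of fun i j => A j (e (σ i) : ι)) = Mᵀ.submatrix σ id := rfl
    rw [this, det_permute, det_transpose]
    rcases Int.units_eq_one_or (Equiv.Perm.sign σ) with h | h <;> simp [h, CharTwo.neg_eq]

theorem choose_hammingNorm (x : ι → ZMod 2) (i : ℕ) :
    ((hammingNorm x).choose i : ZMod 2) = ∑ S ∈ powersetCard i (univ : Finset ι), ∏ t ∈ S, x t := by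
  rw [hammingNorm, ← card_powersetCard, Finset.cast_card]
  refine (sum_congr rfl fun S hS => ?_).trans
    (sum_subset (powersetCard_mono (filter_subset _ _)) fun S hS hS' => ?_)
  · symm
    refine prod_eq_one fun t ht => ?_
    exact ZMod.eq_one_of_ne_zero_two (mem_filter.mp ((mem_powersetCard.mp hS).1 ht)).2
  · by_contra h
    refine hS' (mem_powersetCard.mpr ⟨fun t ht => ?_, (mem_powersetCard.mp hS).2⟩)
    exact mem_filter.mpr ⟨mem_univ _, fun h0 => h (prod_eq_zero ht h0)⟩

theorem exists_odd_choose_hammingNorm (A : Matrix κ ι (ZMod 2)) (hA : (A * Aᵀ).det ≠ 0) (s : ℕ) :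
    ∃ l : κ → ZMod 2, Odd ((hammingNorm (l ᵥ* A) + s).choose (Fintype.card κ)) := by
  have key : ∑ l : κ → ZMod 2,
      (((hammingNorm (l ᵥ* A) + s).choose (Fintype.card κ) : ℕ) : ZMod 2) = (A * Aᵀ).det := by
    have : ∀ i, ∑ l : κ → ZMod 2, ((hammingNorm (l ᵥ* A)).choose i : ZMod 2) =
        ∑ S ∈ powersetCard i (univ : Finset ι), ∑ l : κ → ZMod 2, ∏ t ∈ S, (l ᵥ* A) t := by
      intro i
      simp_rw [choose_hammingNorm]
      exact sum_comm
    simp_rw [Nat.add_choose_eq, Nat.cast_sum, Nat.cast_mul]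
    rw [sum_comm, Finset.sum_eq_single (Fintype.card κ, 0)]
    · simp only [Nat.choose_zero_right, Nat.cast_one, mul_one]
      rw [this, det_mul_transpose_eq_sum]
    · rintro ⟨i, j⟩ hij hne
      rw [← sum_mul, this, sum_eq_zero, zero_mul]
      intro S hS
      refine sum_prod_vecMul_eq_zero A S ?_
      rw [(mem_powersetCard.mp hS).2]
      rw [HasAntidiagonal.mem_antidiagonal] at hij
      simp only at hij
      have : j ≠ 0 := by
        rintro rfl
        exact hne (by rw [← hij, add_zero])
      lia
    · simp
  by_contra! h
  refine hA (key ▸ sum_eq_zero fun l _ => ?_)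
  exact (ZMod.natCast_eq_zero_iff_even).mpr (Nat.not_odd_iff_even.mp (h l))

end CharTwo

theorem mod_eq_of_odd_choose_two_pow_sub_one (a w : ℕ) (h : Odd (w.choose (2 ^ a - 1))) :
    w % 2 ^ a = 2 ^ a - 1 := by
  induction a generalizing w with
  | zero => simp [Nat.mod_one]
  | succ a ih =>
    have hp : 0 < 2 ^ a := by positivity
    have hl := Choose.choose_modEq_choose_mod_mul_choose_div_nat (p := 2) (n := w)
      (k := 2 ^ (a + 1) - 1)
    have h1 : (2 ^ (a + 1) - 1) % 2 = 1 := by rw [pow_succ]; lia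
    have h2 : (2 ^ (a + 1) - 1) / 2 = 2 ^ a - 1 := by rw [pow_succ]; lia
    rw [h1, h2, Nat.choose_one_right] at hl
    rw [Nat.odd_iff, hl, ← Nat.odd_iff, Nat.odd_mul] at h
    have := ih _ h.2
    have h3 := Nat.odd_iff.mp h.1
    rw [pow_succ, mul_comm, Nat.mod_mul, this]
    lia

theorem le_mod_of_odd_choose_two_pow_sub_two (a w : ℕ) (h : Odd (w.choose (2 ^ (a + 1) - 2))) :
    2 ^ (a + 1) - 2 ≤ w % 2 ^ (a + 1) := by
  have hl := Choose.choose_modEq_choose_mod_mul_choose_div_nat (p := 2) (n := w)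
    (k := 2 ^ (a + 1) - 2)
  have h1 : (2 ^ (a + 1) - 2) % 2 = 0 := by rw [pow_succ]; lia
  have h2 : (2 ^ (a + 1) - 2) / 2 = 2 ^ a - 1 := by rw [pow_succ]; lia
  rw [h1, h2, Nat.choose_zero_right, one_mul] at hl
  rw [Nat.odd_iff, hl, ← Nat.odd_iff] at h
  have := mod_eq_of_odd_choose_two_pow_sub_one a _ h
  rw [pow_succ, mul_comm, Nat.mod_mul, this]
  lia

section Symplectic

variable {V : Type*} [AddCommGroup V] [Module (ZMod 2) V] [FiniteDimensional (ZMod 2) V]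

/-- A subspace on which a symmetric form is alternating contains a family of `2 * r` vectors with
nonsingular Gram matrix as soon as its dimension exceeds that of its radical by `2 * r`. -/
theorem exists_gram_det_ne_zero (B : LinearMap.BilinForm (ZMod 2) V)
    (hB : ∀ x y, B x y = B y x) (r : ℕ) (C : Submodule (ZMod 2) V) (hC : ∀ x ∈ C, B x x = 0)
    (hr : Module.finrank (ZMod 2) (C ⊓ B.orthogonal C : Submodule (ZMod 2) V) + 2 * r ≤
      Module.finrank (ZMod 2) C) :
    ∃ (κ : Type) (_ : Fintype κ) (_ : DecidableEq κ) (v : κ → V), Fintype.card κ = 2 * r ∧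
      (∀ i, v i ∈ C) ∧ (Matrix.of fun i j => B (v i) (v j)).det ≠ 0 := by
  induction r generalizing C with
  | zero => exact ⟨Empty, inferInstance, inferInstance, Empty.elim, by simp, by simp, by simp⟩
  | succ r ih =>
    obtain ⟨x, hx, y, hy, hxy⟩ : ∃ x ∈ C, ∃ y ∈ C, B x y = 1 := by
      by_contra! h
      have hle : C ≤ C ⊓ B.orthogonal C := fun y hy => ⟨hy, fun x hx => by
        by_contra h0
        exact h x hx y hy (ZMod.eq_one_of_ne_zero_two h0)⟩
      have := Submodule.finrank_mono hle
      lia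
    have hyx : B y x = 1 := by rw [hB, hxy]
    let φ : V →ₗ[ZMod 2] ZMod 2 × ZMod 2 := (B x).prod (B y)
    let C' := C ⊓ LinearMap.ker φ
    have mem_C' : ∀ z, z ∈ C' ↔ z ∈ C ∧ B x z = 0 ∧ B y z = 0 := by
      intro z
      simp [C', φ, LinearMap.mem_ker]
    have hdim : Module.finrank (ZMod 2) C ≤ Module.finrank (ZMod 2) C' + 2 := by
      have h1 : Module.finrank (ZMod 2) ↥(C ⊔ LinearMap.ker φ) + Module.finrank (ZMod 2) C' =
          Module.finrank (ZMod 2) C + Module.finrank (ZMod 2) (LinearMap.ker φ) :=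
        Submodule.finrank_sup_add_finrank_inf_eq C (LinearMap.ker φ)
      have h2 := φ.finrank_range_add_finrank_ker
      have h3 := Submodule.finrank_le (LinearMap.range φ)
      have h4 := Submodule.finrank_le (C ⊔ LinearMap.ker φ)
      rw [Module.finrank_prod, Module.finrank_self] at h3
      lia
    have hrad : C' ⊓ B.orthogonal C' ≤ C ⊓ B.orthogonal C := by
      rintro z ⟨hz, hz'⟩
      obtain ⟨hzC, hxz, hyz⟩ := (mem_C' z).mp hz
      refine ⟨hzC, fun c hc => ?_⟩
      have hc' : c - B y c • x - B x c • y ∈ C' := by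
        refine (mem_C' _).mpr ⟨C.sub_mem (C.sub_mem hc (C.smul_mem _ hx)) (C.smul_mem _ hy), ?_, ?_⟩
        · simp [hC x hx, hxy]
        · simp [hC y hy, hyx]
      have : B (c - B y c • x - B x c • y) z = 0 := hz' _ hc'
      simpa [hxz, hyz] using this
    obtain ⟨κ, _, _, v, hcard, hv, hdet⟩ := ih C' (fun z hz => hC z hz.1) (by
      have := Submodule.finrank_mono hrad
      lia)
    refine ⟨Fin 2 ⊕ κ, inferInstance, inferInstance, Sum.elim ![x, y] v, ?_, ?_, ?_⟩
    · simp [hcard]; ring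
    · rintro (i | i)
      · fin_cases i <;> simpa
      · exact (hv i).1
    · have hblock : (Matrix.of fun i j => B (Sum.elim ![x, y] v i) (Sum.elim ![x, y] v j)) =
          Matrix.fromBlocks !![0, 1; 1, 0] 0 0 (Matrix.of fun i j => B (v i) (v j)) := by
        ext (i | i) (j | j)
        · fin_cases i <;> fin_cases j <;> simp [hC x hx, hC y hy, hxy, hyx]
        · have := (mem_C' _).mp (hv j)
          fin_cases i <;> simp [this]
        · have := (mem_C' _).mp (hv i)
          fin_cases j <;> simp [hB (v i), this]
        · simp
      rw [hblock, det_fromBlocks_zero₂₁, det_fin_two_of]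
      simpa using hdet

end Symplectic

theorem dotProduct_one_eq_hammingNorm {ι : Type*} [Fintype ι] (x : ι → ZMod 2) :
    x ⬝ᵥ 1 = (hammingNorm x : ZMod 2) := by
  have := choose_hammingNorm x 1
  rw [Nat.choose_one_right] at this
  simp [this, powersetCard_one, dotProduct_one]

theorem dotProduct_self_eq_dotProduct_one {ι : Type*} [Fintype ι] (x : ι → ZMod 2) :
    x ⬝ᵥ x = x ⬝ᵥ 1 := by
  refine sum_congr rfl fun t _ => ?_
  rw [Pi.one_apply]
  generalize x t = b
  revert b; decide

/-- A binary linear code of codimension at most `m` and length `2 ^ (a + 1) + 2 * m` contains words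
of every even weight strictly between `2 * m` and `2 ^ (a + 1)`. -/
theorem exists_orthogonal_of_hammingNorm {ι τ : Type*} [Fintype ι] [Fintype τ] (v : τ → ι → ZMod 2)
    (a j : ℕ) (hι : Fintype.card ι = 2 ^ (a + 1) + 2 * Fintype.card τ) (hj : Even j)
    (hmj : 2 * Fintype.card τ < j) (hja : j < 2 ^ (a + 1)) :
    ∃ x : ι → ZMod 2, (∀ i, v i ⬝ᵥ x = 0) ∧ hammingNorm x = j := by
  classical
  let B : LinearMap.BilinForm (ZMod 2) (ι → ZMod 2) := dotProductBilin (ZMod 2) (ZMod 2)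
  have hBdot : ∀ x y, B x y = x ⬝ᵥ y := fun _ _ => rfl
  have hsymm : ∀ x y, B x y = B y x := fun x y => dotProduct_comm x y
  have hrefl : B.IsRefl := fun x y h => by rw [hsymm, h]
  have hnd : B.Nondegenerate := by
    refine hrefl.nondegenerate_iff_separatingLeft.mpr fun x hx => ?_
    exact dotProduct_eq_zero x hx
  let u : Option τ → ι → ZMod 2 := fun o => o.elim 1 v
  let W := Submodule.span (ZMod 2) (Set.range u)
  have hW : Module.finrank (ZMod 2) W ≤ Fintype.card τ + 1 := by
    exact (finrank_range_le_card (R := ZMod 2) u).trans (by simp)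
  let C := B.orthogonal W
  have hCu : ∀ x ∈ C, ∀ o, u o ⬝ᵥ x = 0 := fun x hx o =>
    hx _ (Submodule.subset_span (Set.mem_range_self o))
  have hC1 : ∀ x ∈ C, x ⬝ᵥ 1 = 0 := fun x hx => by
    rw [dotProduct_comm]; exact hCu x hx none
  have hCself : ∀ x ∈ C, B x x = 0 := fun x hx => by
    rw [hBdot, dotProduct_self_eq_dotProduct_one, hC1 x hx]
  have hdimC := LinearMap.BilinForm.finrank_orthogonal hnd W
  have hdimR : Module.finrank (ZMod 2) (C ⊓ B.orthogonal C : Submodule (ZMod 2) (ι → ZMod 2)) ≤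
      Fintype.card τ + 1 := by
    refine (Submodule.finrank_mono inf_le_right).trans ?_
    rw [LinearMap.BilinForm.orthogonal_orthogonal hnd hrefl]
    exact hW
  rw [Module.finrank_fintype_fun_eq_card] at hdimC
  have hpow : 2 ^ (a + 1) = 2 * 2 ^ a := pow_succ' 2 a
  obtain ⟨κ, _, _, A, hκ, hA, hdet⟩ :=
    exists_gram_det_ne_zero B hsymm (2 ^ a - 1) C hCself (by
      change _ ≤ Module.finrank (ZMod 2) (B.orthogonal W)
      lia)
  have hκ' : Fintype.card κ = 2 ^ (a + 1) - 2 := by lia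
  obtain ⟨l, hl⟩ := exists_odd_choose_hammingNorm (Matrix.of A) hdet (2 * 2 ^ (a + 1) - 2 - j)
  set x := l ᵥ* Matrix.of A with hx
  have hxC : x ∈ C := by
    have : x = ∑ i, l i • A i := by
      ext t; simp [hx, vecMul, dotProduct]
    rw [this]
    exact C.sum_mem fun i _ => C.smul_mem _ (hA i)
  refine ⟨x, fun i => hCu x hxC (some i), ?_⟩
  have heven : Even (hammingNorm x) := by
    rw [← ZMod.natCast_eq_zero_iff_even, ← dotProduct_one_eq_hammingNorm, hC1 x hxC]
  have hwle : hammingNorm x ≤ 2 ^ (a + 1) + 2 * Fintype.card τ := hι ▸ card_le_univ _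
  rw [hκ'] at hl
  have hmod := le_mod_of_odd_choose_two_pow_sub_two a _ hl
  have hdiv := Nat.div_add_mod (hammingNorm x + (2 * 2 ^ (a + 1) - 2 - j)) (2 ^ (a + 1))
  have hlt := Nat.mod_lt (hammingNorm x + (2 * 2 ^ (a + 1) - 2 - j))
    (show 2 ^ (a + 1) > 0 by positivity)
  obtain ⟨w, hw⟩ := heven
  obtain ⟨i, hi⟩ := hj
  generalize (hammingNorm x + (2 * 2 ^ (a + 1) - 2 - j)) / 2 ^ (a + 1) = q at hdiv
  generalize (hammingNorm x + (2 * 2 ^ (a + 1) - 2 - j)) % 2 ^ (a + 1) = s at *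
  generalize 2 ^ (a + 1) = Q at *
  obtain _ | _ | q := q
  · lia
  · have : 2 * (2 ^ a) + s = hammingNorm x + (2 * Q - 2 - j) := by rw [← hdiv]; lia
    lia
  · have : Q * (q + 1 + 1) = Q * q + 2 * Q := by ring
    lia

/-- The support version of `exists_orthogonal_of_hammingNorm`. -/
theorem exists_subset_even_inter_of_card_eq {α : Type*} [DecidableEq α] (𝒜 : Finset (Finset α))
    (T : Finset α) (a j : ℕ) (hT : T.card = 2 ^ (a + 1) + 2 * 𝒜.card) (hj : Even j)
    (hmj : 2 * 𝒜.card < j) (hja : j < 2 ^ (a + 1)) :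
    ∃ S ⊆ T, S.card = j ∧ ∀ A ∈ 𝒜, Even (A ∩ S).card := by
  obtain ⟨x, hx, hxj⟩ := exists_orthogonal_of_hammingNorm
    (fun (A : 𝒜) (t : T) => if (t : α) ∈ (A : Finset α) then (1 : ZMod 2) else 0) a j
    (by simpa using hT) hj (by simpa using hmj) hja
  refine ⟨(univ.filter fun t => x t ≠ 0).map (Function.Embedding.subtype _), ?_, ?_, ?_⟩
  · intro t ht
    obtain ⟨t, _, rfl⟩ := mem_map.mp ht
    exact t.2
  · rw [card_map]; exact hxj
  · intro A hA
    have h := hx ⟨A, hA⟩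
    have hcard : A ∩ (univ.filter fun t => x t ≠ 0).map (Function.Embedding.subtype _) =
        (univ.filter fun t : T => (t : α) ∈ A ∧ x t ≠ 0).map (Function.Embedding.subtype _) := by
      ext t
      simp only [mem_inter, mem_map, mem_filter, mem_univ, true_and]
      constructor
      · rintro ⟨htA, t, ht, rfl⟩
        exact ⟨t, ⟨htA, ht⟩, rfl⟩
      · rintro ⟨t, ⟨htA, ht⟩, rfl⟩
        exact ⟨htA, t, ht, rfl⟩
    rw [hcard, card_map, ← ZMod.natCast_eq_zero_iff_even, natCast_card_filter]
    refine (sum_congr rfl fun t _ => ?_).trans h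
    by_cases htA : (t : α) ∈ A
    · by_cases hxt : x t = 0
      · simp [hxt]
      · simp [htA, ZMod.eq_one_of_ne_zero_two hxt]
    · simp [htA]

/-- If `U` has sufficiently more than `k` elements, some
`k`-subset of `U` meets every member of `𝒜` evenly. -/
theorem exists_card_eq_even_inter {α : Type*} [DecidableEq α] (𝒜 : Finset (Finset α)) (a : ℕ)
    (ha : 4 * 𝒜.card + 4 ≤ 2 ^ (a + 1)) (k : ℕ) (hk : Even k) (hmk : 2 * 𝒜.card < k)
    (U : Finset α) (hU : k + 2 ^ (a + 1) + 2 * 𝒜.card ≤ U.card) :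
    ∃ S ⊆ U, S.card = k ∧ ∀ A ∈ 𝒜, Even (A ∩ S).card := by
  induction k using Nat.strong_induction_on generalizing U with
  | _ k ih =>
    obtain ⟨T, hTU, hT⟩ := exists_subset_card_eq (s := U) (n := 2 ^ (a + 1) + 2 * 𝒜.card) (by lia)
    by_cases hka : k < 2 ^ (a + 1)
    · obtain ⟨S, hST, hS⟩ := exists_subset_even_inter_of_card_eq 𝒜 T a k hT hk hmk hka
      exact ⟨S, hST.trans hTU, hS⟩
    · obtain ⟨S₁, hS₁T, hS₁, heven₁⟩ := exists_subset_even_inter_of_card_eq 𝒜 T a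
        (2 * 𝒜.card + 2) hT ⟨𝒜.card + 1, by ring⟩ (by lia) (by lia)
      have hS₁U := hS₁T.trans hTU
      obtain ⟨S₂, hS₂U, hS₂, heven₂⟩ := ih (k - (2 * 𝒜.card + 2)) (by lia)
        (by obtain ⟨i, hi⟩ := hk; exact ⟨i - (𝒜.card + 1), by lia⟩) (by lia) (U \ S₁) (by
          rw [card_sdiff_of_subset hS₁U]; lia)
      have hdisj : Disjoint S₁ S₂ := disjoint_of_subset_right hS₂U disjoint_sdiff
      refine ⟨S₁ ∪ S₂, union_subset hS₁U (hS₂U.trans sdiff_subset), ?_, fun A hA => ?_⟩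
      · rw [card_union_of_disjoint hdisj]; lia
      · rw [inter_union_distrib_left, card_union_of_disjoint
          (disjoint_of_subset_left inter_subset_right
            (disjoint_of_subset_right inter_subset_right hdisj))]
        exact (heven₁ A hA).add (heven₂ A hA)

/-- Theorem 4: for every `0 < ε < 0.5` there is `δ = δ(ε) > 0` such that for all positive
`n`, every odd `c` with `1 ≤ c ≤ n/2` and `r = 2c`, and every even `k` with
`εn < k < (1-ε)n`, every family of `r`-element subsets of `[n]` that is a system of
unbiased representatives for all `k`-bicolorings of `[n]` has cardinality at least `δn`;
i.e. `γ(n,k,r) ≥ δn`. -/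
theorem stmt_16 (ε : ℝ) (hε : 0 < ε) (hε2 : ε < 0.5) :
    ∃ δ : ℝ, 0 < δ ∧
      ∀ n c k : ℕ, 0 < n → Odd c → 1 ≤ c → 2 * c ≤ n →
        Even k → ε * n < (k : ℝ) → (k : ℝ) < (1 - ε) * n →
        ∀ 𝒜 : Finset (Finset (Fin n)),
          (∀ A ∈ 𝒜, A.card = 2 * c) →
          (∀ P : Finset (Fin n), P.card = k →
            ∃ A ∈ 𝒜, (A ∩ P).card = (A ∩ Pᶜ).card) →
          δ * n ≤ (𝒜.card : ℝ) := by
  refine ⟨ε / 18, by positivity, ?_⟩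
  intro n c k hn hc _ _ hk hk1 hk2 𝒜 h𝒜 hrep
  by_contra! hlt
  have hkn : k ≤ n := by
    have : (k : ℝ) ≤ n := hk2.le.trans (by nlinarith [(Nat.cast_nonneg n : (0 : ℝ) ≤ n)])
    exact_mod_cast this
  have hpos : 0 < 𝒜.card := by
    obtain ⟨P, -, hP⟩ := exists_subset_card_eq (s := (univ : Finset (Fin n))) (n := k) (by simpa)
    obtain ⟨A, hA, -⟩ := hrep P hP
    exact card_pos.mpr ⟨A, hA⟩
  have h18k : 18 * 𝒜.card < k := by
    have : (18 * 𝒜.card : ℝ) < k := by linarith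
    exact_mod_cast this
  have h18n : 18 * 𝒜.card + k < n := by
    have : (18 * 𝒜.card + k : ℝ) < n := by linarith
    exact_mod_cast this
  obtain ⟨a, ha, ha'⟩ : ∃ a, 4 * 𝒜.card + 4 ≤ 2 ^ (a + 1) ∧ 2 ^ (a + 1) ≤ 8 * 𝒜.card + 8 := by
    refine ⟨Nat.log 2 (4 * 𝒜.card + 4), (Nat.lt_pow_succ_log_self one_lt_two _).le, ?_⟩
    have := Nat.pow_log_le_self 2 (x := 4 * 𝒜.card + 4) (by lia)
    rw [pow_succ]
    lia
  obtain ⟨P, -, hP, heven⟩ := exists_card_eq_even_inter 𝒜 a ha k hk (by lia) univ (by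
    rw [card_univ, Fintype.card_fin]; lia)
  obtain ⟨A, hA, hbal⟩ := hrep P hP
  have hsum : (A ∩ P).card + (A ∩ Pᶜ).card = 2 * c := by
    rw [← h𝒜 A hA, ← sdiff_eq_inter_compl, card_inter_add_card_sdiff]
  have hAP : (A ∩ P).card = c := by lia
  exact Nat.not_even_iff_odd.mpr hc (hAP ▸ heven A hA)
end
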